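/- Let η>0 be small and η₀ = η^{2/η}. For every non-decreasing 1-Lipschitz function f:[0,1]→[0,1] there exist a partition 0=A₁<A₂<⋯<A_{H+1}=1 and a sequence 0 ≤ s₁ < s₂ < ⋯ < s_H ≤ 1 such that for each 1 ≤ h ≤ H: (i) A_{h+1}−A_h ≥ η₀/η; (ii) f(x) ≥ f(A_h) + s_h(x−A_h) − η(A_{h+1}−A_h) for all x∈[A_h,A_{h+1}]; (iii) f(A_{h+1}) ≤ f(A_h) + (s_h+3η)(A_{h+1}−A_h); and (iv) s_H ≥ f(1) − f(0) − η. -/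

import Mathlib

noncomputable section

def Grp4 (f : ℝ → ℝ) (η L a b s : ℝ) : Prop :=
  L ≤ b - a ∧ (∀ x ∈ Set.Icc a b, f a + s * (x - a) - η * (b - a) ≤ f x) ∧
    f b ≤ f a + (s + 3 * η) * (b - a)

def IsCh4 (f : ℝ → ℝ) (η L : ℝ) (H : ℕ) (A s : ℕ → ℝ) (b : ℝ) : Prop :=
  A 1 = 0 ∧ A (H + 1) = b ∧
    (∀ h, 1 ≤ h → h ≤ H → A h < A (h + 1) ∧ 0 ≤ s h ∧ Grp4 f η L (A h) (A (h + 1)) (s h)) ∧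
    (∀ h, 1 ≤ h → h < H → s h < s (h + 1))

lemma ext4 {f : ℝ → ℝ} {η L : ℝ} {H : ℕ} {A s : ℕ → ℝ} {b c σ : ℝ}
    (hc : IsCh4 f η L H A s b) (hs : 1 ≤ H → s H < σ) (hbc : b < c) (h0 : 0 ≤ σ)
    (hg : Grp4 f η L b c σ) :
    ∃ A' s', IsCh4 f η L (H + 1) A' s' c ∧ s' (H + 1) = σ := by
  obtain ⟨h1, h2, h3, h4⟩ := hc
  refine ⟨fun i => if i = H + 2 then c else A i, fun i => if i = H + 1 then σ else s i,
    ⟨?_, ?_, ?_, ?_⟩, ?_⟩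
  · simp [h1]
  · simp
  · intro h hh hH
    by_cases e : h = H + 1
    · subst e
      simpa [h2] using ⟨hbc, h0, hg⟩
    · have e1 : h ≠ H + 2 := by omega
      have e2 : h + 1 ≠ H + 2 := by omega
      simp only [if_neg e, if_neg e1, if_neg e2]
      exact h3 h hh (by omega)
  · intro h hh hH
    have e : h ≠ H + 1 := by omega
    simp only [if_neg e]
    by_cases e1 : h = H
    · subst e1
      simpa using hs hh
    · have e2 : h + 1 ≠ H + 1 := by omega
      simp only [if_neg e2]
      exact h4 h hh (by omega)
  · simp

lemma thr4 (η : ℝ) (hη : 0 < η) (hη1 : η < 1/2) (l : ℕ → ℝ) :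
    ∀ (n : ℕ) (S : Finset ℕ), S.card = n + 1 → (∀ i ∈ S, 0 ≤ l i) → 
      ∃ j ∈ S, (∑ i ∈ S, l i) * (η ^ 2) ^ n ≤ l j ∧
        ∑ i ∈ S with l i < l j, l i ≤ η * l j := by
  intro n
  induction n with
  | zero =>
    intro S hS h0
    obtain ⟨a, rfl⟩ := Finset.card_eq_one.mp hS
    refine ⟨a, by simp, by simp, ?_⟩
    have : 0 ≤ l a := h0 a (by simp)
    simp [Finset.filter_singleton]
    positivity
  | succ n ih =>
    intro S hS h0
    have hne : S.Nonempty := by rw [← Finset.card_pos]; omega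
    obtain ⟨a, haS, hmax⟩ := S.exists_max_image l hne
    have hcard : (S.erase a).card = n + 1 := by rw [Finset.card_erase_of_mem haS]; omega
    have hsum := Finset.add_sum_erase S l haS
    have hla := h0 a haS
    have hW : 0 ≤ ∑ i ∈ S.erase a, l i :=
      Finset.sum_nonneg (fun i hi => h0 i (Finset.mem_of_mem_erase hi))
    by_cases hc : ∑ i ∈ S.erase a, l i ≤ η * l a
    · refine ⟨a, haS, ?_, ?_⟩
      · have hp : (η ^ 2) ^ (n + 1) ≤ η ^ 2 := by
          rw [pow_succ]
          have : (η ^ 2) ^ n ≤ 1 := pow_le_one₀ (by positivity) (by nlinarith)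
          nlinarith [sq_nonneg η]
        calc (∑ i ∈ S, l i) * (η ^ 2) ^ (n + 1) ≤ ((1 + η) * l a) * η ^ 2 := by
              apply mul_le_mul _ hp (by positivity) (by positivity)
              linarith
          _ = ((1 + η) * η ^ 2) * l a := by ring
          _ ≤ 1 * l a := by
              apply mul_le_mul_of_nonneg_right _ hla
              nlinarith [sq_nonneg η]
          _ = l a := one_mul _
      · refine le_trans (Finset.sum_le_sum_of_subset_of_nonneg ?_ ?_) hc
        · intro i hi
          simp only [Finset.mem_filter] at hi
          refine Finset.mem_erase.mpr ⟨?_, hi.1⟩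
          rintro rfl
          exact lt_irrefl _ hi.2
        · intro i hi _
          exact h0 i (Finset.mem_of_mem_erase hi)
    · push Not at hc
      obtain ⟨j, hj, h1, h2⟩ := ih (S.erase a) hcard
        (fun i hi => h0 i (Finset.mem_of_mem_erase hi))
      have hjS := Finset.mem_of_mem_erase hj
      refine ⟨j, hjS, le_trans ?_ h1, ?_⟩
      · rw [pow_succ', ← mul_assoc]
        apply mul_le_mul_of_nonneg_right _ (by positivity)
        rw [← hsum]
        have e1 : η ^ 2 * l a ≤ η * ∑ i ∈ S.erase a, l i := by nlinarith
        have e2 : (η + η ^ 2) * ∑ i ∈ S.erase a, l i ≤ 1 * ∑ i ∈ S.erase a, l i := by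
          apply mul_le_mul_of_nonneg_right _ hW
          nlinarith
        linarith
      · convert h2 using 2
        ext i
        simp only [Finset.mem_filter, Finset.mem_erase]
        constructor
        · rintro ⟨h, h'⟩
          refine ⟨⟨?_, h⟩, h'⟩
          rintro rfl
          exact absurd (hmax j hjS) (not_le.mpr h')
        · rintro ⟨⟨_, h⟩, h'⟩
          exact ⟨h, h'⟩

lemma core4 (η : ℝ) (hη : 0 < η) (hη1 : η < 1/2)
    (f : ℝ → ℝ) (hmono : MonotoneOn f (Set.Icc 0 1))
    (hl : ∀ x ∈ Set.Icc (0:ℝ) 1, ∀ y ∈ Set.Icc (0:ℝ) 1, x ≤ y → f y - f x ≤ y - x)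
    (g : ℝ → ℝ) (g0 : g 0 = 0) (g1 : g 1 = 1)
    (hg : ∀ t ∈ Set.Icc (0:ℝ) 1, g t ∈ Set.Icc (0:ℝ) 1 ∧
      ∀ x ∈ Set.Icc (0:ℝ) 1, f (g t) - t * g t ≤ f x - t * x)
    (M : ℕ) (t : ℕ → ℝ) (tm : Monotone t) (t0 : t 0 = 0) (t1 : t (M + 1) = 1)
    (tD : ∀ k, t (k + 1) ≤ t k + 2 * η ∨ 1 ≤ t k + 3 * η)
    (tE : ∀ k, f 1 - f 0 - η ≤ t k ∨ t (k + 1) ≤ f 1 - f 0 - η)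
    (L : ℝ) (hL : L ≤ (η ^ 2) ^ M) :
    ∃ (H : ℕ) (A s : ℕ → ℝ), 1 ≤ H ∧ IsCh4 f η L H A s 1 ∧ s H ≤ 1 ∧ f 1 - f 0 - η ≤ s H := by
  have tI : ∀ k, k ≤ M + 1 → t k ∈ Set.Icc (0:ℝ) 1 := fun k hk =>
    ⟨t0 ▸ tm (Nat.zero_le k), t1 ▸ tm hk⟩
  have gm : ∀ i j, i ≤ j → j ≤ M + 1 → g (t i) ≤ g (t j) := by
    intro i j hij hj
    rcases (tm hij).eq_or_lt with e | e
    · rw [e]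
    · obtain ⟨a1, a2⟩ := hg _ (tI i (by omega))
      obtain ⟨b1, b2⟩ := hg _ (tI j hj)
      have := a2 _ b1
      have := b2 _ a1
      by_contra hlt
      push Not at hlt
      nlinarith [mul_pos (sub_pos.mpr e) (sub_pos.mpr hlt)]
  set l : ℕ → ℝ := fun k => g (t (k + 1)) - g (t k) with hldef
  have l0 : ∀ i, i < M + 1 → 0 ≤ l i := fun i hi => sub_nonneg.mpr (gm i (i+1) (by omega) (by omega))
  obtain ⟨j, hjS, hj1, hj2⟩ := thr4 η hη hη1 l M (Finset.range (M + 1)) (by simp)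
    (fun i hi => l0 i (Finset.mem_range.mp hi))
  have hsum : ∑ i ∈ Finset.range (M + 1), l i = 1 := by
    rw [hldef, Finset.sum_range_sub (fun k => g (t k)), t0, t1, g0, g1]; norm_num
  rw [hsum, one_mul] at hj1
  set τ := l j with hτ
  have τL : L ≤ τ := hL.trans hj1
  have τ0 : 0 < τ := lt_of_lt_of_le (by positivity) hj1
  have hjM : j < M + 1 := Finset.mem_range.mp hjS
  -- junk bound
  have junk : ∀ p q, p ≤ q → q ≤ M + 1 → (∀ i, p ≤ i → i < q → l i < τ) →
      g (t q) - g (t p) ≤ η * τ := by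
    intro p q hpq hq hs
    rw [← Finset.sum_Ico_sub (fun k => g (t k)) hpq]
    refine le_trans (Finset.sum_le_sum_of_subset_of_nonneg ?_ ?_) hj2
    · intro i hi
      rw [Finset.mem_Ico] at hi
      simp only [Finset.mem_filter, Finset.mem_range]
      exact ⟨by omega, hs i hi.1 hi.2⟩
    · intro i hi _
      simp only [Finset.mem_filter, Finset.mem_range] at hi
      exact l0 i hi.1
  have grp : ∀ p k q, p ≤ k → k < q → q ≤ M + 1 → τ ≤ l k → (∀ i, p ≤ i → i < k → l i < τ) →
      (∀ i, k + 1 ≤ i → i < q → l i < τ) → Grp4 f η L (g (t p)) (g (t q)) (t k) ∧ 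
        g (t p) < g (t q) := by
    intro p k q hpk hkq hq hk hs1 hs2
    have j1 := junk p k hpk (by omega) hs1
    have j2 := junk (k+1) q (by omega) hq hs2
    have m1 := gm p k hpk (by omega)
    have m2 := gm (k+1) q (by omega) hq
    have hk' : τ ≤ g (t (k+1)) - g (t k) := hk
    obtain ⟨pI, -⟩ := hg _ (tI p (by omega))
    obtain ⟨kI, kmin⟩ := hg _ (tI k (by omega))
    obtain ⟨k1I, k1min⟩ := hg _ (tI (k+1) (by omega))
    obtain ⟨qI, -⟩ := hg _ (tI q hq)
    have tk := tI k (by omega)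
    have tk1 := tI (k+1) (by omega)
    have hlen : τ ≤ g (t q) - g (t p) := by linarith
    have hlen2 : η * τ ≤ η * (g (t q) - g (t p)) := by gcongr
    refine ⟨⟨by linarith, ?_, ?_⟩, by linarith⟩
    · intro x hx
      have hxI : x ∈ Set.Icc (0:ℝ) 1 := ⟨pI.1.trans hx.1, hx.2.trans qI.2⟩
      have h1 := kmin x hxI
      have h2 := hmono pI kI m1
      have h3 : t k * (g (t k) - g (t p)) ≤ 1 * (g (t k) - g (t p)) :=
        mul_le_mul_of_nonneg_right tk.2 (by linarith)
      linarith
    · rcases tD k with h | h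
      · have h1 := hl _ k1I _ qI m2
        have h2 := k1min _ pI
        have h3 : t (k+1) * (g (t (k+1)) - g (t p)) ≤ (t k + 2 * η) * (g (t q) - g (t p)) := by
          apply mul_le_mul h (by linarith) (by linarith)
          linarith [tk.1]
        linarith
      · have h1 := hl _ pI _ qI (by linarith)
        have h2 : 1 * (g (t q) - g (t p)) ≤ (t k + 3 * η) * (g (t q) - g (t p)) :=
          mul_le_mul_of_nonneg_right h (by linarith)
        linarith
  have main : ∀ n, n ≤ M + 1 → ∃ p, p ≤ n ∧ (∀ i, p ≤ i → i < n → l i < τ) ∧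
      ∃ H A s, IsCh4 f η L H A s (g (t p)) ∧ (1 ≤ H → s H < t p) := by
    intro n
    induction n with
    | zero =>
      intro _
      refine ⟨0, le_rfl, by intros; omega, 0, fun _ => 0, fun _ => 0, ⟨rfl, ?_, ?_, ?_⟩, ?_⟩
      · simp [t0, g0]
      all_goals intros; omega
    | succ n ih =>
      intro hn
      obtain ⟨p, hp, hsh, H, A, s, hch, hlt⟩ := ih (by omega)
      by_cases hc : l n < τ
      · refine ⟨p, by omega, ?_, H, A, s, hch, hlt⟩
        intro i h1 h2
        rcases Nat.lt_succ_iff_lt_or_eq.mp h2 with h | h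
        · exact hsh i h1 h
        · rwa [h]
      · push Not at hc
        obtain ⟨G, hG⟩ := grp p n (n+1) hp (by omega) hn hc hsh (by intros; omega)
        obtain ⟨A', s', hch', hs'⟩ := ext4 hch (fun h => (hlt h).trans_le (tm hp)) hG
          (tI n (by omega)).1 G
        refine ⟨n+1, le_rfl, by intros; omega, H+1, A', s', hch', fun _ => ?_⟩
        rw [hs']
        refine lt_of_le_of_ne (tm (by omega)) ?_
        intro e
        have : l n = 0 := by simp only [hldef]; rw [← e]; ring
        linarith
  -- last long index
  obtain ⟨k, hkS, hkmax⟩ := ((Finset.range (M+1)).filter (fun i => τ ≤ l i)).exists_max_image id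
    ⟨j, by simp [hjM, hτ]⟩
  simp only [Finset.mem_filter, Finset.mem_range, id] at hkS hkmax
  obtain ⟨p, hp, hsh, H, A, s, hch, hlt⟩ := main k (by omega)
  have hr : ∀ i, k + 1 ≤ i → i < M + 1 → l i < τ := by
    intro i h1 h2
    by_contra h
    push Not at h
    have := hkmax i ⟨h2, h⟩
    omega
  obtain ⟨G, hG⟩ := grp p k (M+1) hp hkS.1 le_rfl hkS.2 hsh hr
  obtain ⟨A', s', hch', hs'⟩ := ext4 hch (fun h => (hlt h).trans_le (tm hp)) hG
          (tI k (by omega)).1 G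
  rw [t1, g1] at hch'
  refine ⟨H+1, A', s', by omega, hch', ?_, ?_⟩
  · rw [hs']; exact (tI k (by omega)).2
  · rw [hs']
    by_contra hcon
    have hE := (tE k).resolve_left hcon
    push Not at hcon
    have jr := junk (k+1) (M+1) (by omega) le_rfl hr
    rw [t1, g1] at jr
    obtain ⟨k1I, k1min⟩ := hg _ (tI (k+1) (by omega))
    have z := k1min 0 (by simp)
    have y := hl _ k1I 1 (by simp) k1I.2
    have tk := (tI k (by omega)).1
    have hτ1 : τ ≤ 1 := by
      have := hkS.2
      have := (hg _ (tI k (by omega))).1.1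
      have := k1I.2
      simp only [hldef] at *
      linarith
    have hητ : η * τ ≤ η := by nlinarith
    have w : t (k+1) * g (t (k+1)) ≤ (f 1 - f 0 - η) * g (t (k+1)) :=
      mul_le_mul_of_nonneg_right hE k1I.1
    have hDp : 0 < f 1 - f 0 - η := by linarith
    rcases k1I.2.eq_or_lt with e | e
    · rw [e] at z y w; linarith
    · nlinarith [mul_pos hDp (sub_pos.mpr e)]

/-- Shmerkin's decomposition of a non-decreasing 1-Lipschitz function `f : [0,1] → [0,1]`:
a partition `0 = A₁ < ⋯ < A_{H+1} = 1` and slopes `s₁ < ⋯ < s_H` approximating `f` from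
below on each piece, with the stated properties. -/
theorem stmt4 (η : ℝ) (hη : 0 < η) (hη1 : η < 1/2)
    (f : ℝ → ℝ) (hmono : MonotoneOn f (Set.Icc 0 1))
    (hlip : LipschitzOnWith 1 f (Set.Icc 0 1))
    (hmaps : Set.MapsTo f (Set.Icc 0 1) (Set.Icc 0 1)) :
    ∃ (H : ℕ) (A : ℕ → ℝ) (s : ℕ → ℝ),
      1 ≤ H ∧ A 1 = 0 ∧ A (H + 1) = 1 ∧
      (∀ h, 1 ≤ h → h ≤ H → A h < A (h + 1)) ∧
      (∀ h, 1 ≤ h → h < H → s h < s (h + 1)) ∧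
      0 ≤ s 1 ∧ s H ≤ 1 ∧
      (∀ h, 1 ≤ h → h ≤ H →
        η ^ (2 * η⁻¹) / η ≤ A (h + 1) - A h ∧
        (∀ x ∈ Set.Icc (A h) (A (h + 1)),
          f (A h) + s h * (x - A h) - η * (A (h + 1) - A h) ≤ f x) ∧
        f (A (h + 1)) ≤ f (A h) + (s h + 3 * η) * (A (h + 1) - A h)) ∧
      f 1 - f 0 - η ≤ s H := by
  have hl : ∀ x ∈ Set.Icc (0:ℝ) 1, ∀ y ∈ Set.Icc (0:ℝ) 1, x ≤ y → f y - f x ≤ y - x := by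
    intro x hx y hy hxy
    have h := hlip.dist_le_mul y hy x hx
    rw [Real.dist_eq, Real.dist_eq, abs_of_nonneg (sub_nonneg.mpr hxy)] at h
    have := le_abs_self (f y - f x)
    simp at h
    linarith
  have hex : ∀ t : ℝ, ∃ y, (t = 0 → y = 0) ∧ (t = 1 → y = 1) ∧ (t ∈ Set.Icc (0:ℝ) 1 →
      y ∈ Set.Icc (0:ℝ) 1 ∧ ∀ x ∈ Set.Icc (0:ℝ) 1, f y - t * y ≤ f x - t * x) := by
    intro t
    by_cases h0 : t = 0
    · subst h0
      refine ⟨0, by simp, by simp, fun _ => ⟨by simp, fun x hx => ?_⟩⟩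
      have := hmono (by simp) hx hx.1
      linarith
    by_cases h1 : t = 1
    · subst h1
      refine ⟨1, by simp, by simp, fun _ => ⟨by simp, fun x hx => ?_⟩⟩
      have := hl x hx 1 (by simp) hx.2
      linarith
    have hcont : ContinuousOn (fun x => f x - t * x) (Set.Icc 0 1) :=
      hlip.continuousOn.sub (by fun_prop)
    obtain ⟨y, hy, hmin⟩ := isCompact_Icc.exists_isMinOn ⟨(0:ℝ), by simp⟩ hcont
    exact ⟨y, fun h => absurd h h0, fun h => absurd h h1, fun _ => ⟨hy, fun x hx => hmin hx⟩⟩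
  choose g hg0 hg1 hg using hex
  have hi : 2 < η⁻¹ := by
    rw [lt_inv_comm₀ (by norm_num) hη]; linarith
  have hii : η * η⁻¹ = 1 := mul_inv_cancel₀ hη.ne'
  have hD1 : f 1 - f 0 ≤ 1 := by
    have := hl 0 (by simp) 1 (by simp) (by norm_num); linarith
  have hD0 : 0 ≤ f 1 - f 0 := by
    have := hmono (by simp : (0:ℝ) ∈ Set.Icc (0:ℝ) 1) (by simp : (1:ℝ) ∈ Set.Icc (0:ℝ) 1)
      (by norm_num)
    linarith
  set D := f 1 - f 0 with hD
  have hgrid : ∃ (M : ℕ) (t : ℕ → ℝ), Monotone t ∧ t 0 = 0 ∧ t (M + 1) = 1 ∧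
      (∀ k, t (k + 1) ≤ t k + 2 * η ∨ 1 ≤ t k + 3 * η) ∧
      (∀ k, D - η ≤ t k ∨ t (k + 1) ≤ D - η) ∧ (M : ℝ) ≤ η⁻¹ - 1 / 2 := by
    by_cases h3 : 1 / 3 ≤ η
    · refine ⟨1, fun k => if k = 0 then 0 else if k = 1 then max 0 (D - η) else 1, ?_, ?_, ?_,
        ?_, ?_, ?_⟩
      · apply monotone_nat_of_le_succ
        intro n
        rcases n with _ | _ | n
        · simp
        · simp; linarith
        · simp
      · simp
      · simp
      · intro k
        right
        rcases k with _ | _ | n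
        · simp; linarith
        · simp; have := le_max_left 0 (D - η); linarith
        · simp; linarith
      · intro k
        rcases k with _ | _ | n
        · simp
          rcases le_total D η with h | h
          · left; exact h
          · right; exact h
        · left; simp
        · left; simp; linarith
      · push_cast; linarith
    · push Not at h3
      have hi3 : 3 < η⁻¹ := by
        rw [lt_inv_comm₀ (by norm_num) hη]; linarith
      set m := ⌈(D - η) / (2 * η)⌉₊ with hm
      set q := ⌈(1 - D + η) / (2 * η)⌉₊ with hq
      have m1 : D - η ≤ m * (2 * η) := by
        rw [← div_le_iff₀ (by positivity)]; exact Nat.le_ceil _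
      have q1 : 1 - D + η ≤ q * (2 * η) := by
        rw [← div_le_iff₀ (by positivity)]; exact Nat.le_ceil _
      have q2 : ((q:ℝ) - 1) * (2 * η) < 1 - D + η := by
        rw [← lt_div_iff₀ (by positivity)]
        have := Nat.ceil_lt_add_one (a := (1 - D + η) / (2 * η))
          (div_nonneg (by linarith) (by positivity))
        linarith
      have hq0 : 0 < q := Nat.ceil_pos.mpr (div_pos (by linarith) (by positivity))
      have mq : ((m:ℝ) + q - 1) * (2 * η) ≤ 1 + 2 * η := by
        rcases le_total D η with h | h
        · have : m = 0 := Nat.ceil_eq_zero.mpr (div_nonpos_of_nonpos_of_nonneg (by linarith)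
            (by positivity))
          rw [this]; push_cast; linarith
        · have m2 : ((m:ℝ) - 1) * (2 * η) < D - η := by
            rw [← lt_div_iff₀ (by positivity)]
            have := Nat.ceil_lt_add_one (a := (D - η) / (2 * η))
              (div_nonneg (by linarith) (by positivity))
            linarith
          linarith
      have hM : m + q - 1 + 1 = m + q := by omega
      have hMr : ((m + q - 1 : ℕ) : ℝ) = (m:ℝ) + q - 1 := by
        have : ((m + q - 1 + 1 : ℕ) : ℝ) = ((m + q : ℕ) : ℝ) := by rw [hM]
        push_cast at this
        linarith
      refine ⟨m + q - 1, fun k => max 0 (min 1 (D - η + ((k:ℝ) - m) * (2 * η))), ?_, ?_, ?_,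
        ?_, ?_, ?_⟩
      · intro a b hab
        have : (a:ℝ) ≤ b := by exact_mod_cast hab
        dsimp only
        gcongr
      · apply max_eq_left
        apply min_le_of_right_le
        push_cast; linarith
      · rw [hM]
        have : min 1 (D - η + (((m + q : ℕ):ℝ) - m) * (2 * η)) = 1 := by
          apply min_eq_left
          push_cast; linarith
        simp only [this]; norm_num
      · intro k
        left
        push_cast
        apply max_le
        · have := le_max_left 0 (min 1 (D - η + ((k:ℝ) - m) * (2 * η)))
          linarith
        · have := le_max_right 0 (min 1 (D - η + ((k:ℝ) - m) * (2 * η)))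
          refine le_trans ?_ (add_le_add_left this _)
          rw [← min_add_add_right]
          apply min_le_min
          · linarith
          · linarith
      · intro k
        rcases le_total D η with h | h
        · left
          exact le_trans (by linarith) (le_max_left _ _)
        rcases Nat.lt_or_ge k m with h' | h'
        · right
          have : (k:ℝ) + 1 ≤ m := by exact_mod_cast h'
          apply max_le (by linarith)
          apply min_le_of_right_le
          push_cast
          nlinarith
        · left
          have : (m:ℝ) ≤ k := by exact_mod_cast h'
          apply le_max_of_le_right
          apply le_min (by linarith)
          nlinarith
      · rw [hMr]
        have h1 : ((m:ℝ) + q - 1) * (2 * η) ≤ (η⁻¹ - 1 / 2) * (2 * η) := by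
          refine mq.trans ?_
          linarith
        exact le_of_mul_le_mul_right h1 (by positivity)
  obtain ⟨M, t, tm, t0, t1, tD, tE, hM⟩ := hgrid
  have hL : η ^ (2 * η⁻¹) / η ≤ (η ^ 2) ^ M := by
    have e : η ^ (2 * η⁻¹ - 1) = η ^ (2 * η⁻¹) / η := Real.rpow_sub_one hη.ne' _
    rw [← e, ← pow_mul, ← Real.rpow_natCast]
    apply Real.rpow_le_rpow_of_exponent_ge hη (by linarith)
    push_cast
    linarith
  obtain ⟨H, A, s, hH, ⟨c1, c2, c3, c4⟩, hs1, hs2⟩ := core4 η hη hη1 f hmono hl g (hg0 0 rfl)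
    (hg1 1 rfl) hg M t tm t0 t1 tD tE _ hL
  exact ⟨H, A, s, hH, c1, c2, fun h a b => (c3 h a b).1, c4, (c3 1 le_rfl hH).2.1, hs1,
    fun h a b => (c3 h a b).2.2, hs2⟩
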